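/- Let B be a bialgebra over a field k, C a left B-module coalgebra, V a left Yetter–Drinfeld module over B, and W a k-vector space which is a left C-comodule (γ(w)=w⁽ᶜ⁾⊗w₍₀₎ ∈ C⊗W) and a left B-module with γ(b·w)=b₍₁₎·w⁽ᶜ⁾ ⊗ b₍₂₎·w₍₀₎. Then V⊗W, equipped with the C-coaction γ(v⊗w) := (v₍₋₁₎·w⁽ᶜ⁾) ⊗ v₍₀₎⊗w₍₀₎ and the B-action b·(v⊗w) := (b₍₁₎·v)⊗(b₍₂₎·w), is again a left C-comodule in left B-modules: γ is a coassociative counital C-coaction and γ(b·x) = b₍₁₎·x⁽ᶜ⁾ ⊗ b₍₂₎·x₍₀₎ for all x ∈ V⊗W. -/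

import Mathlib

/-!
STATEMENT 5: For a bialgebra `B`, a left `B`-module coalgebra `C`, a left Yetter–Drinfeld
module `V`, and a space `W` which is a left `C`-comodule and left `B`-module with
`γ(b·w) = b₍₁₎·w⁽ᶜ⁾ ⊗ b₍₂₎·w₍₀₎`, the tensor product `V ⊗ W` with the `C`-coaction
`γ(v⊗w) = (v₍₋₁₎·w⁽ᶜ⁾) ⊗ v₍₀₎⊗w₍₀₎` and the tensor `B`-action is again a left
`C`-comodule in left `B`-modules.
-/

open scoped TensorProduct

noncomputable section

/-- The `C`-coaction `γ(v ⊗ w) = (v₍₋₁₎ · w⁽ᶜ⁾) ⊗ v₍₀₎ ⊗ w₍₀₎` on `V ⊗ W`. -/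
def inducedCCoaction {k B C V W : Type} [Field k] [Ring B] [Bialgebra k B]
    [AddCommGroup C] [Module k C] [Coalgebra k C]
    [AddCommGroup V] [Module k V] [AddCommGroup W] [Module k W]
    (actC : B →ₗ[k] C →ₗ[k] C) (δV : V →ₗ[k] B ⊗[k] V) (γW : W →ₗ[k] C ⊗[k] W) :
    V ⊗[k] W →ₗ[k] C ⊗[k] (V ⊗[k] W) :=
  LinearMap.rTensor (V ⊗[k] W) (TensorProduct.lift actC)
    ∘ₗ (TensorProduct.tensorTensorTensorComm k B V C W).toLinearMap
    ∘ₗ TensorProduct.map δV γW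

/-- The tensor product action `b · (v ⊗ w) = (b₍₁₎ · v) ⊗ (b₍₂₎ · w)`. -/
def tensorAction {k B V W : Type} [Field k] [Ring B] [Bialgebra k B]
    [AddCommGroup V] [Module k V] [AddCommGroup W] [Module k W]
    (actV : B →ₗ[k] V →ₗ[k] V) (actW : B →ₗ[k] W →ₗ[k] W) :
    B ⊗[k] (V ⊗[k] W) →ₗ[k] V ⊗[k] W :=
  TensorProduct.map (TensorProduct.lift actV) (TensorProduct.lift actW)
    ∘ₗ (TensorProduct.tensorTensorTensorComm k B B V W).toLinearMap
    ∘ₗ LinearMap.rTensor (V ⊗[k] W) (Coalgebra.comul (R := k))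

section Aux

variable {k B C V W : Type} [Field k] [Ring B] [Bialgebra k B]
    [AddCommGroup C] [Module k C]
    [AddCommGroup V] [Module k V] [AddCommGroup W] [Module k W]

/-- `(b ⊗ v) ⊗ (c ⊗ w) ↦ b·c ⊗ (v ⊗ w)`. -/
def auxG (actC : B →ₗ[k] C →ₗ[k] C) :
    (B ⊗[k] V) ⊗[k] (C ⊗[k] W) →ₗ[k] C ⊗[k] (V ⊗[k] W) :=
  LinearMap.rTensor (V ⊗[k] W) (TensorProduct.lift actC)
    ∘ₗ (TensorProduct.tensorTensorTensorComm k B V C W).toLinearMap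

/-- `(p ⊗ q) ⊗ (v ⊗ w) ↦ p·v ⊗ q·w`. -/
def auxM (actV : B →ₗ[k] V →ₗ[k] V) (actW : B →ₗ[k] W →ₗ[k] W) :
    (B ⊗[k] B) ⊗[k] (V ⊗[k] W) →ₗ[k] V ⊗[k] W :=
  TensorProduct.map (TensorProduct.lift actV) (TensorProduct.lift actW)
    ∘ₗ (TensorProduct.tensorTensorTensorComm k B B V W).toLinearMap

theorem auxM_tmul (actV : B →ₗ[k] V →ₗ[k] V) (actW : B →ₗ[k] W →ₗ[k] W) (p q : B)
    (x : V ⊗[k] W) : auxM actV actW ((p ⊗ₜ q) ⊗ₜ x) = TensorProduct.map (actV p) (actW q) x := by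
  induction x with
  | zero => simp only [TensorProduct.tmul_zero, map_zero]
  | add x y hx hy => simp only [TensorProduct.tmul_add, map_add, hx, hy]
  | tmul v w => rfl

/-- `p ⊗ q ↦ p s₍₋₁₎ ⊗ q·s₍₀₎`. -/
def auxL (actV : B →ₗ[k] V →ₗ[k] V) (s : B ⊗[k] V) : B ⊗[k] B →ₗ[k] B ⊗[k] V :=
  LinearMap.applyₗ s ∘ₗ TensorProduct.homTensorHomMap (RingHom.id k) B V B V
    ∘ₗ TensorProduct.map (LinearMap.mul k B) actV

/-- `p ⊗ q ↦ p·t₁ ⊗ q·t₂`. -/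
def auxS (actC : B →ₗ[k] C →ₗ[k] C) (bW : B →ₗ[k] W →ₗ[k] W) (t : C ⊗[k] W) :
    B ⊗[k] B →ₗ[k] C ⊗[k] W :=
  LinearMap.applyₗ t ∘ₗ TensorProduct.homTensorHomMap (RingHom.id k) C W C W
    ∘ₗ TensorProduct.map actC bW

/-- `p ⊗ q ↦ (p·v)₍₋₁₎ q ⊗ (p·v)₍₀₎`. -/
def auxR (actV : B →ₗ[k] V →ₗ[k] V) (δV : V →ₗ[k] B ⊗[k] V) (v : V) :
    B ⊗[k] B →ₗ[k] B ⊗[k] V :=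
  TensorProduct.lift
    ((LinearMap.rTensorHom V ∘ₗ (LinearMap.mul k B).flip).flip ∘ₗ δV ∘ₗ actV.flip v)

/-- `(b ⊗ (b' ⊗ v)) ⊗ (c ⊗ (c' ⊗ w)) ↦ b·c ⊗ (b'·c' ⊗ (v ⊗ w))`. -/
def auxPhi (actC : B →ₗ[k] C →ₗ[k] C) :
    (B ⊗[k] (B ⊗[k] V)) ⊗[k] (C ⊗[k] (C ⊗[k] W)) →ₗ[k] C ⊗[k] (C ⊗[k] (V ⊗[k] W)) :=
  TensorProduct.map (TensorProduct.lift actC) (auxG actC)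
    ∘ₗ (TensorProduct.tensorTensorTensorComm k B (B ⊗[k] V) C (C ⊗[k] W)).toLinearMap

variable [Coalgebra k C]

theorem auxCoassocL (actC : B →ₗ[k] C →ₗ[k] C)
    (hC : ∀ (b : B) (c : C), Coalgebra.comul (R := k) (actC b c)
      = auxM actC actC (Coalgebra.comul (R := k) b ⊗ₜ Coalgebra.comul (R := k) c))
    (s : B ⊗[k] V) (t : C ⊗[k] W) :
    (TensorProduct.assoc k C C (V ⊗[k] W))
        ((LinearMap.rTensor (V ⊗[k] W) (Coalgebra.comul (R := k))) (auxG actC (s ⊗ₜ t)))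
      = auxPhi actC ((TensorProduct.assoc k B B V)
          ((LinearMap.rTensor V (Coalgebra.comul (R := k))) s)
        ⊗ₜ (TensorProduct.assoc k C C W)
          ((LinearMap.rTensor W (Coalgebra.comul (R := k))) t)) := by
  induction s with
  | zero => simp only [TensorProduct.zero_tmul, map_zero]
  | add s s' hs hs' => simp only [TensorProduct.add_tmul, map_add, hs, hs']
  | tmul b v =>
    induction t with
    | zero => simp only [TensorProduct.tmul_zero, map_zero]
    | add t t' ht ht' => simp only [TensorProduct.tmul_add, map_add, ht, ht']
    | tmul c w =>
      change (TensorProduct.assoc k C C (V ⊗[k] W))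
        (Coalgebra.comul (R := k) (actC b c) ⊗ₜ (v ⊗ₜ w)) = _
      rw [hC, LinearMap.rTensor_tmul, LinearMap.rTensor_tmul]
      generalize Coalgebra.comul (R := k) b = p
      generalize Coalgebra.comul (R := k) c = q
      induction p with
      | zero => simp only [TensorProduct.zero_tmul, map_zero]
      | add s s' hs hs' => simp only [TensorProduct.add_tmul, map_add, hs, hs']
      | tmul b b' =>
        induction q with
        | zero => simp only [TensorProduct.tmul_zero, TensorProduct.zero_tmul, map_zero]
        | add t t' ht ht' =>
          simp only [TensorProduct.tmul_add, TensorProduct.add_tmul, map_add, ht, ht']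
        | tmul c c' => rfl

theorem auxCoassocR (actC : B →ₗ[k] C →ₗ[k] C) (δV : V →ₗ[k] B ⊗[k] V)
    (γW : W →ₗ[k] C ⊗[k] W) (s : B ⊗[k] V) (t : C ⊗[k] W) :
    (LinearMap.lTensor C (inducedCCoaction actC δV γW)) (auxG actC (s ⊗ₜ t))
      = auxPhi actC (LinearMap.lTensor B δV s ⊗ₜ LinearMap.lTensor C γW t) := by
  induction s with
  | zero => simp only [TensorProduct.zero_tmul, map_zero]
  | add s s' hs hs' => simp only [TensorProduct.add_tmul, map_add, hs, hs']
  | tmul b v =>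
    induction t with
    | zero => simp only [TensorProduct.tmul_zero, map_zero]
    | add t t' ht ht' => simp only [TensorProduct.tmul_add, map_add, ht, ht']
    | tmul c w => rfl

theorem auxCounit (actC : B →ₗ[k] C →ₗ[k] C)
    (hactCε : ∀ (b : B) (c : C), Coalgebra.counit (R := k) (actC b c)
        = Coalgebra.counit (R := k) b * Coalgebra.counit (R := k) c)
    (s : B ⊗[k] V) (t : C ⊗[k] W) :
    (TensorProduct.lid k (V ⊗[k] W))
        ((LinearMap.rTensor (V ⊗[k] W) (Coalgebra.counit (R := k))) (auxG actC (s ⊗ₜ t)))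
      = (TensorProduct.lid k V) ((LinearMap.rTensor V (Coalgebra.counit (R := k))) s)
        ⊗ₜ (TensorProduct.lid k W) ((LinearMap.rTensor W (Coalgebra.counit (R := k))) t) := by
  induction s with
  | zero => simp only [TensorProduct.zero_tmul, map_zero]
  | add s s' hs hs' => simp only [TensorProduct.add_tmul, map_add, hs, hs']
  | tmul b v =>
    induction t with
    | zero => simp only [TensorProduct.tmul_zero, map_zero]
    | add t t' ht ht' => simp only [TensorProduct.tmul_add, map_add, ht, ht']
    | tmul c w =>
      change (TensorProduct.lid k (V ⊗[k] W))
        (Coalgebra.counit (R := k) (actC b c) ⊗ₜ (v ⊗ₜ w)) = _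
      rw [hactCε]
      simp only [LinearMap.rTensor_tmul, TensorProduct.lid_tmul, TensorProduct.smul_tmul_smul]

end Aux

theorem tensor_comodule_over_module_coalgebra
    {k B C V W : Type} [Field k] [Ring B] [Bialgebra k B]
    [AddCommGroup C] [Module k C] [Coalgebra k C]
    [AddCommGroup V] [Module k V] [AddCommGroup W] [Module k W]
    -- `C` is a left `B`-module coalgebra
    (actC : B →ₗ[k] C →ₗ[k] C)
    (hactC1 : ∀ c : C, actC 1 c = c)
    (hactCm : ∀ (b b' : B) (c : C), actC (b * b') c = actC b (actC b' c))
    (hactCΔ : ∀ (b : B) (c : C) (n : ℕ) (b1 b2 : Fin n → B),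
      Coalgebra.comul (R := k) b = ∑ i, b1 i ⊗ₜ[k] b2 i →
      Coalgebra.comul (R := k) (actC b c)
        = ∑ i, TensorProduct.map (actC (b1 i)) (actC (b2 i)) (Coalgebra.comul (R := k) c))
    (hactCε : ∀ (b : B) (c : C),
      Coalgebra.counit (R := k) (actC b c)
        = Coalgebra.counit (R := k) b * Coalgebra.counit (R := k) c)
    -- `V` is a left Yetter–Drinfeld module over `B`
    (actV : B →ₗ[k] V →ₗ[k] V)
    (hactV1 : ∀ v : V, actV 1 v = v)
    (hactVm : ∀ (b b' : B) (v : V), actV (b * b') v = actV b (actV b' v))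
    (δV : V →ₗ[k] B ⊗[k] V)
    (hδV1 : ∀ v : V, (TensorProduct.assoc k B B V)
        ((LinearMap.rTensor V (Coalgebra.comul (R := k))) (δV v))
        = (LinearMap.lTensor B δV) (δV v))
    (hδV2 : ∀ v : V, (TensorProduct.lid k V)
        ((LinearMap.rTensor V (Coalgebra.counit (R := k))) (δV v)) = v)
    (hYD : ∀ (b : B) (v : V) (n : ℕ) (b1 b2 : Fin n → B),
      Coalgebra.comul (R := k) b = ∑ i, b1 i ⊗ₜ[k] b2 i →
      ∑ i, TensorProduct.map (LinearMap.mulLeft k (b1 i)) (actV (b2 i)) (δV v)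
        = ∑ i, LinearMap.rTensor V (LinearMap.mulRight k (b2 i)) (δV (actV (b1 i) v)))
    -- `W` is a left `C`-comodule and left `B`-module with compatibility
    (γW : W →ₗ[k] C ⊗[k] W)
    (hγW1 : ∀ w : W, (TensorProduct.assoc k C C W)
        ((LinearMap.rTensor W (Coalgebra.comul (R := k))) (γW w))
        = (LinearMap.lTensor C γW) (γW w))
    (hγW2 : ∀ w : W, (TensorProduct.lid k W)
        ((LinearMap.rTensor W (Coalgebra.counit (R := k))) (γW w)) = w)
    (bW : B →ₗ[k] W →ₗ[k] W)
    (hbW1 : ∀ w : W, bW 1 w = w)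
    (hbWm : ∀ (b b' : B) (w : W), bW (b * b') w = bW b (bW b' w))
    (hWcompat : ∀ (b : B) (w : W) (n : ℕ) (b1 b2 : Fin n → B),
      Coalgebra.comul (R := k) b = ∑ i, b1 i ⊗ₜ[k] b2 i →
      γW (bW b w) = ∑ i, TensorProduct.map (actC (b1 i)) (bW (b2 i)) (γW w)) :
    -- `γ` is a coassociative, counital `C`-coaction on `V ⊗ W`
    (∀ x : V ⊗[k] W, (TensorProduct.assoc k C C (V ⊗[k] W))
        ((LinearMap.rTensor (V ⊗[k] W) (Coalgebra.comul (R := k)))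
          (inducedCCoaction actC δV γW x))
        = (LinearMap.lTensor C (inducedCCoaction actC δV γW))
            (inducedCCoaction actC δV γW x)) ∧
    (∀ x : V ⊗[k] W, (TensorProduct.lid k (V ⊗[k] W))
        ((LinearMap.rTensor (V ⊗[k] W) (Coalgebra.counit (R := k)))
          (inducedCCoaction actC δV γW x)) = x) ∧
    -- `V ⊗ W` is a left `B`-module
    (∀ x : V ⊗[k] W, tensorAction actV bW ((1 : B) ⊗ₜ[k] x) = x) ∧
    (∀ (b b' : B) (x : V ⊗[k] W),
      tensorAction actV bW ((b * b') ⊗ₜ[k] x)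
        = tensorAction actV bW (b ⊗ₜ[k] tensorAction actV bW (b' ⊗ₜ[k] x))) ∧
    -- the compatibility `γ(b·x) = b₍₁₎·x⁽ᶜ⁾ ⊗ b₍₂₎·x₍₀₎`
    (∀ (b : B) (x : V ⊗[k] W) (n : ℕ) (b1 b2 : Fin n → B),
      Coalgebra.comul (R := k) b = ∑ i, b1 i ⊗ₜ[k] b2 i →
      inducedCCoaction actC δV γW (tensorAction actV bW (b ⊗ₜ[k] x))
        = ∑ i, TensorProduct.map (actC (b1 i))
            (tensorAction actV bW ∘ₗ TensorProduct.mk k B (V ⊗[k] W) (b2 i))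
            (inducedCCoaction actC δV γW x)) := by
  have hΓ : ∀ (v : V) (w : W), inducedCCoaction actC δV γW (v ⊗ₜ w)
      = auxG actC (δV v ⊗ₜ γW w) := fun v w => rfl
  have hT : ∀ (b : B) (x : V ⊗[k] W), tensorAction actV bW (b ⊗ₜ x)
      = auxM actV bW (Coalgebra.comul (R := k) b ⊗ₜ x) := fun b x => rfl
  have hC : ∀ (b : B) (c : C), Coalgebra.comul (R := k) (actC b c)
      = auxM actC actC (Coalgebra.comul (R := k) b ⊗ₜ Coalgebra.comul (R := k) c) := by
    intro b c
    obtain ⟨n, b1, b2, h⟩ := TensorProduct.exists_sum_tmul_eq (Coalgebra.comul (R := k) b)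
    rw [hactCΔ b c n b1 b2 h, h, TensorProduct.sum_tmul, map_sum]
    refine Finset.sum_congr rfl fun i _ => ?_
    rw [auxM_tmul]
  refine ⟨?_, ?_, ?_, ?_, ?_⟩
  · intro x
    induction x with
    | zero => simp only [map_zero]
    | add x y hx hy => simp only [map_add, hx, hy]
    | tmul v w =>
      rw [hΓ]
      have h1 := auxCoassocL actC hC (δV v) (γW w)
      have h2 := auxCoassocR actC δV γW (δV v) (γW w)
      rw [h1, h2, hδV1, hγW1]
  · intro x
    induction x with
    | zero => simp only [map_zero]
    | add x y hx hy => simp only [map_add, hx, hy]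
    | tmul v w =>
      rw [hΓ, auxCounit actC hactCε, hδV2, hγW2]
  · intro x
    rw [hT, Bialgebra.comul_one, Algebra.TensorProduct.one_def]
    rw [auxM_tmul]
    have e1 : actV 1 = LinearMap.id := LinearMap.ext hactV1
    have e2 : bW 1 = LinearMap.id := LinearMap.ext hbW1
    rw [e1, e2, TensorProduct.map_id, LinearMap.id_apply]
  · intro b b' x
    rw [hT, hT, hT, Bialgebra.comul_mul]
    generalize Coalgebra.comul (R := k) b = s
    generalize Coalgebra.comul (R := k) b' = t
    induction s with
    | zero => simp only [zero_mul, TensorProduct.zero_tmul, map_zero]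
    | add s s' hs hs' => simp only [add_mul, TensorProduct.add_tmul, map_add, hs, hs']
    | tmul p q =>
      induction t with
      | zero => simp only [mul_zero, TensorProduct.zero_tmul, TensorProduct.tmul_zero, map_zero]
      | add t t' ht ht' =>
        simp only [mul_add, TensorProduct.add_tmul, TensorProduct.tmul_add, map_add, ht, ht']
      | tmul p' q' =>
        rw [Algebra.TensorProduct.tmul_mul_tmul]
        simp only [auxM_tmul]
        have e1 : actV (p * p') = actV p ∘ₗ actV p' := LinearMap.ext (hactVm p p')
        have e2 : bW (q * q') = bW q ∘ₗ bW q' := LinearMap.ext (hbWm q q')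
        rw [e1, e2, TensorProduct.map_comp, LinearMap.comp_apply]
  · intro b x n b1 b2 hb
    induction x with
    | zero => simp only [map_zero, TensorProduct.tmul_zero, Finset.sum_const_zero]
    | add x y hx hy =>
      simp only [map_add, TensorProduct.tmul_add, hx, hy, Finset.sum_add_distrib]
    | tmul v w =>
      have hYD' : ∀ b : B, auxL actV (δV v) (Coalgebra.comul (R := k) b)
          = auxR actV δV v (Coalgebra.comul (R := k) b) := by
        intro b
        obtain ⟨n, b1, b2, h⟩ := TensorProduct.exists_sum_tmul_eq (Coalgebra.comul (R := k) b)
        rw [h, map_sum, map_sum]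
        exact hYD b v n b1 b2 h
      have hW' : ∀ b : B, γW (bW b w) = auxS actC bW (γW w) (Coalgebra.comul (R := k) b) := by
        intro b
        obtain ⟨n, b1, b2, h⟩ := TensorProduct.exists_sum_tmul_eq (Coalgebra.comul (R := k) b)
        rw [h, map_sum]
        exact hWcompat b w n b1 b2 h
      have hL1 : ∀ s : B ⊗[k] B, inducedCCoaction actC δV γW (auxM actV bW (s ⊗ₜ (v ⊗ₜ w)))
          = auxG actC (TensorProduct.map (δV ∘ₗ actV.flip v) (auxS actC bW (γW w))
            (LinearMap.lTensor B (Coalgebra.comul (R := k)) s)) := by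
        intro s
        induction s with
        | zero => simp only [TensorProduct.zero_tmul, map_zero]
        | add s s' hs hs' => simp only [TensorProduct.add_tmul, map_add, hs, hs']
        | tmul p q =>
          rw [auxM_tmul, TensorProduct.map_tmul, hΓ, hW']
          rfl
      have hL2 : auxG actC ∘ₗ TensorProduct.map (δV ∘ₗ actV.flip v) (auxS actC bW (γW w))
            ∘ₗ (TensorProduct.assoc k B B B).toLinearMap
          = auxG actC ∘ₗ TensorProduct.map (auxR actV δV v)
              (((LinearMap.lTensorHom C) ∘ₗ bW).flip (γW w)) := by
        ext p q r
        change auxG actC (δV (actV p v) ⊗ₜ TensorProduct.map (actC q) (bW r) (γW w))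
          = auxG actC (LinearMap.rTensor V (LinearMap.mulRight k q) (δV (actV p v))
              ⊗ₜ LinearMap.lTensor C (bW r) (γW w))
        generalize δV (actV p v) = s
        generalize γW w = t
        induction s with
        | zero => simp only [TensorProduct.zero_tmul, map_zero]
        | add s s' hs hs' => simp only [TensorProduct.add_tmul, map_add, hs, hs']
        | tmul a v' =>
          induction t with
          | zero => simp only [TensorProduct.tmul_zero, map_zero]
          | add t t' ht ht' => simp only [TensorProduct.tmul_add, map_add, ht, ht']
          | tmul c w' =>
            change actC a (actC q c) ⊗ₜ (v' ⊗ₜ bW r w') = actC (a * q) c ⊗ₜ (v' ⊗ₜ bW r w')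
            rw [hactCm]
      have hL3 : ∀ s : B ⊗[k] B, TensorProduct.map (auxR actV δV v)
              (((LinearMap.lTensorHom C) ∘ₗ bW).flip (γW w))
              (LinearMap.rTensor B (Coalgebra.comul (R := k)) s)
          = TensorProduct.map (auxL actV (δV v))
              (((LinearMap.lTensorHom C) ∘ₗ bW).flip (γW w))
              (LinearMap.rTensor B (Coalgebra.comul (R := k)) s) := by
        intro s
        induction s with
        | zero => simp only [map_zero]
        | add s s' hs hs' => simp only [map_add, hs, hs']
        | tmul p q =>
          rw [LinearMap.rTensor_tmul, TensorProduct.map_tmul, TensorProduct.map_tmul, hYD']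
      have hR : ∀ (p r : B) (q : B ⊗[k] B), auxG actC (TensorProduct.map (auxL actV (δV v))
              (((LinearMap.lTensorHom C) ∘ₗ bW).flip (γW w))
              ((TensorProduct.assoc k B B B).symm (p ⊗ₜ q)))
          = TensorProduct.map (actC p) (auxM actV bW ∘ₗ TensorProduct.mk k (B ⊗[k] B) _ q)
              (auxG actC (δV v ⊗ₜ γW w)) := by
        intro p _ q
        generalize γW w = t
        generalize δV v = s
        induction q with
        | zero =>
          simp only [TensorProduct.tmul_zero, map_zero, LinearMap.comp_zero,
            TensorProduct.map_zero_right, LinearMap.zero_apply]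
        | add q q' hq hq' =>
          simp only [TensorProduct.tmul_add, map_add, hq, hq', LinearMap.comp_add,
            TensorProduct.map_add_right, LinearMap.add_apply]
        | tmul q r =>
          change auxG actC (TensorProduct.map (LinearMap.mulLeft k p) (actV q) s
              ⊗ₜ LinearMap.lTensor C (bW r) t) = _
          induction s with
          | zero => simp only [TensorProduct.zero_tmul, map_zero]
          | add s s' hs hs' => simp only [TensorProduct.add_tmul, map_add, hs, hs']
          | tmul a v' =>
            induction t with
            | zero => simp only [TensorProduct.tmul_zero, map_zero]
            | add t t' ht ht' => simp only [TensorProduct.tmul_add, map_add, ht, ht']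
            | tmul c w' =>
              change actC (p * a) c ⊗ₜ (actV q v' ⊗ₜ bW r w')
                = actC p (actC a c) ⊗ₜ (actV q v' ⊗ₜ bW r w')
              rw [hactCm]
      have hco := Coalgebra.coassoc_apply (R := k) b
      rw [hT, hL1, ← hco]
      have h2 := LinearMap.congr_fun hL2
        (LinearMap.rTensor B (Coalgebra.comul (R := k)) (Coalgebra.comul (R := k) b))
      simp only [LinearMap.comp_apply, LinearEquiv.coe_coe] at h2
      rw [h2, hL3, ← LinearEquiv.symm_apply_apply (TensorProduct.assoc k B B B)
        (LinearMap.rTensor B (Coalgebra.comul (R := k)) (Coalgebra.comul (R := k) b)), hco, hb]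
      simp only [map_sum, LinearMap.lTensor_tmul]
      refine Finset.sum_congr rfl fun i _ => ?_
      rw [hR (b1 i) 1, hΓ]
      rfl

end
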